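/- arXiv:1009.3562 — 2 statements merged into one kernel-verified Lean document; each statement's English description precedes it below -/
import Mathlib

section
/- Fix Φ ∈ [0, π/2] and consider the set S of pairs (α, β) ∈ [0, π/2] × [0, π/2] satisfying cos α · cos β = cos² Φ. Define Eve's fidelity F_E(α, β) = (1 + sin α · sin β)/2. Then for every (α, β) ∈ S one has F_E(α, β) ≤ (1 + sin² Φ)/2, and this maximum is attained at α = β = Φ. In particular, the maximum of F_E over S is achieved exactly when α = β. -/
open Real

/-- Theorem 1 of the paper: fix the disturbance parameter `Φ ∈ [0, π/2]` and let `S`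
be the set of attack-angle pairs `(α, β) ∈ [0, π/2] × [0, π/2]` with
`cos α * cos β = cos² Φ`.  Eve's fidelity `F_E (α, β) = (1 + sin α * sin β) / 2`
satisfies `F_E (α, β) ≤ (1 + sin² Φ)/2` on `S`, this maximum is attained at
`α = β = Φ` (which lies in `S`), and the maximum is achieved exactly when `α = β`. -/
theorem eve_fidelity_max (Φ : ℝ) (hΦ : Φ ∈ Set.Icc 0 (π / 2))
    (S : Set (ℝ × ℝ))
    (hS : S = {p : ℝ × ℝ | p.1 ∈ Set.Icc 0 (π / 2) ∧ p.2 ∈ Set.Icc 0 (π / 2) ∧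
      Real.cos p.1 * Real.cos p.2 = Real.cos Φ ^ 2})
    (F_E : ℝ → ℝ → ℝ)
    (hF : ∀ α β, F_E α β = (1 + Real.sin α * Real.sin β) / 2) :
    (∀ α β, (α, β) ∈ S → F_E α β ≤ (1 + Real.sin Φ ^ 2) / 2) ∧
      ((Φ, Φ) ∈ S ∧ F_E Φ Φ = (1 + Real.sin Φ ^ 2) / 2) ∧
      (∀ α β, (α, β) ∈ S → (F_E α β = (1 + Real.sin Φ ^ 2) / 2 ↔ α = β)) := by
  have sin_mul_sin : ∀ α β, (α, β) ∈ S →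
      sin α * sin β = sin Φ ^ 2 - (1 - cos (α - β)) := by
    intro α β h
    rw [hS] at h
    have hcos : cos α * cos β = cos Φ ^ 2 := h.2.2
    linarith [cos_sub α β, sin_sq_add_cos_sq Φ]
  refine ⟨fun α β h => ?_, ⟨?_, ?_⟩, fun α β h => ?_⟩
  · rw [hF]
    linarith [sin_mul_sin α β h, cos_le_one (α - β)]
  · rw [hS]
    exact ⟨hΦ, hΦ, (sq _).symm⟩
  · rw [hF, sq]
  · have hsin := sin_mul_sin α β h
    rw [hS] at h
    obtain ⟨⟨hα₀, hα₁⟩, ⟨hβ₀, hβ₁⟩, -⟩ := h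
    dsimp only at hα₀ hα₁ hβ₀ hβ₁
    have hπ := pi_pos
    rw [hF, ← sub_eq_zero (a := α),
      ← cos_eq_one_iff_of_lt_of_lt (x := α - β) (by linarith) (by linarith)]
    constructor <;> intro <;> linarith
end

section
/- For every real e with 0 < e < 1/2, one has log₂(1 + 4e − 4e²) > 2e. -/
open Real

/-- For `0 < e < 1/2`, the privacy-amplification function
`τ(e) = log₂ (1 + 4e - 4e²)` strictly exceeds `τ_t(e) = 2e`. -/
theorem tau_gt_two_e (e : ℝ) (h0 : 0 < e) (h1 : e < 1 / 2) :
    Real.logb 2 (1 + 4 * e - 4 * e ^ 2) > 2 * e := by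
  have bernoulli : ((1 : ℝ) + 1) ^ (2 * e) < 1 + 2 * e * 1 :=
    rpow_one_add_lt_one_add_mul_self (by norm_num) one_ne_zero (by linarith) (by linarith)
  rw [one_add_one_eq_two, mul_one] at bernoulli
  have quadratic : 1 + 2 * e < 1 + 4 * e - 4 * e ^ 2 := by nlinarith
  exact (lt_logb_iff_rpow_lt one_lt_two (by linarith)).2 (bernoulli.trans quadratic)
end
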